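/- (The energy score is a strictly proper scoring rule) For a probability measure μ on ℝ^D with finite first moment and a point y ∈ ℝ^D, define the energy score ES(μ, y) = E‖X − y‖ − (1/2)·E‖X − X'‖, where X, X' ~ μ are independent. Then for any two probability measures μ, ν on ℝ^D with finite first moments, E_{Y~ν}[ES(μ, Y)] − E_{Y~ν}[ES(ν, Y)] = (1/2)·ED(μ, ν) ≥ 0; in particular the expected energy score E_{Y~ν}[ES(μ, Y)] over forecasts μ is minimized at μ = ν, and (since ED(μ,ν) = 0 only when μ = ν) the minimizer is unique. -/

import Mathlib

open MeasureTheory Set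

/-- The energy distance between two probability measures `μ`, `ν` on `ℝ^D`:
`ED(μ,ν) = 2·E‖X − Y‖ − E‖X − X'‖ − E‖Y − Y'‖`, where `X, X' ∼ μ`, `Y, Y' ∼ ν` are all
independent and `‖·‖` is the Euclidean norm. -/
noncomputable def energyDist {D : ℕ} (μ ν : Measure (EuclideanSpace ℝ (Fin D))) : ℝ :=
  2 * ∫ p, ‖p.1 - p.2‖ ∂(μ.prod ν) - ∫ p, ‖p.1 - p.2‖ ∂(μ.prod μ)
    - ∫ p, ‖p.1 - p.2‖ ∂(ν.prod ν)

/-- The energy score of a forecast distribution `μ` against an observation `y`: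
`ES(μ, y) = E‖X − y‖ − (1/2)·E‖X − X'‖` with `X, X' ∼ μ` independent. -/
noncomputable def energyScore {D : ℕ} (μ : Measure (EuclideanSpace ℝ (Fin D)))
    (y : EuclideanSpace ℝ (Fin D)) : ℝ :=
  ∫ x, ‖x - y‖ ∂μ - (1 / 2) * ∫ p, ‖p.1 - p.2‖ ∂(μ.prod μ)

section EnergyAux

variable {E : Type*} [NormedAddCommGroup E] [InnerProductSpace ℝ E] [FiniteDimensional ℝ E]
  [MeasurableSpace E] [BorelSpace E]

/-- The weighted kernel whose integral in `t` is proportional to `‖x‖`. -/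
noncomputable def energyKer (x t : E) : ℝ :=
  (1 - Real.cos (inner ℝ x t)) * (‖t‖ ^ (Module.finrank ℝ E + 1))⁻¹

theorem energyKer_nonneg (x t : E) : 0 ≤ energyKer x t := by
  unfold energyKer
  have := Real.cos_le_one (inner ℝ x t)
  have : 0 ≤ 1 - Real.cos (inner ℝ x t) := by linarith
  positivity

theorem energyKer_measurable : Measurable (fun p : E × E => energyKer p.1 p.2) := by
  unfold energyKer
  fun_prop

theorem one_sub_cos_bound (x t : E) :
    1 - Real.cos (inner ℝ x t) ≤ 4 * (1 + ‖x‖ ^ 2) * (‖t‖ ^ 2 * (1 + ‖t‖ ^ 2)⁻¹) := by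
  have h1 : 1 - Real.cos (inner ℝ x t) ≤ 2 := by
    have := Real.neg_one_le_cos (inner ℝ x t)
    linarith
  have h2 : 1 - Real.cos (inner ℝ x t) ≤ ‖x‖ ^ 2 * ‖t‖ ^ 2 / 2 := by
    have h := Real.one_sub_sq_div_two_le_cos (x := inner ℝ x t)
    have h3 : (inner ℝ x t) ^ 2 ≤ (‖x‖ * ‖t‖) ^ 2 :=
      sq_le_sq' (neg_le_of_abs_le (abs_real_inner_le_norm x t)) (real_inner_le_norm x t)
    rw [mul_pow] at h3
    linarith
  rw [← div_eq_mul_inv, ← mul_div_assoc, le_div_iff₀ (by positivity)]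
  have hs : 0 ≤ ‖t‖ ^ 2 := by positivity
  have hx : 0 ≤ ‖x‖ ^ 2 := by positivity
  have h4 := mul_le_mul_of_nonneg_right h1 hs
  have h5 := mul_nonneg hx hs
  nlinarith

theorem integral_cos_prod (μ ν : Measure E) [IsProbabilityMeasure μ] [IsProbabilityMeasure ν]
    (t : E) : ∫ p : E × E, Real.cos (inner ℝ (p.1 - p.2) t) ∂(μ.prod ν) =
      (charFun μ t * (starRingEnd ℂ) (charFun ν t)).re := by
  rw [← charFun_neg, charFun_apply, charFun_apply, ← integral_prod_mul]
  have hint : Integrable (fun p : E × E => Complex.exp (↑(inner ℝ p.1 t) * Complex.I) *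
      Complex.exp (↑(inner ℝ p.2 (-t)) * Complex.I)) (μ.prod ν) := by
    refine Integrable.of_bound (C := 1) (by fun_prop) (Filter.Eventually.of_forall fun p => ?_)
    rw [norm_mul, Complex.norm_exp_ofReal_mul_I, Complex.norm_exp_ofReal_mul_I, mul_one]
  have := integral_re hint
  simp only [RCLike.re_eq_complex_re] at this
  rw [← this]
  refine integral_congr_ae (Filter.Eventually.of_forall fun p => ?_)
  simp only
  rw [← Complex.exp_add, ← add_mul, ← Complex.ofReal_add, Complex.exp_ofReal_mul_I_re,
    inner_neg_right, inner_sub_left, sub_eq_add_neg]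

theorem norm_sub_integrable {μ ν : Measure E} [IsProbabilityMeasure μ] [IsProbabilityMeasure ν]
    (hμ : Integrable (fun x => ‖x‖) μ) (hν : Integrable (fun x => ‖x‖) ν) :
    Integrable (fun p : E × E => ‖p.1 - p.2‖) (μ.prod ν) := by
  refine ((hμ.comp_fst ν).add (hν.comp_snd μ)).mono' (by fun_prop)
    (Filter.Eventually.of_forall fun p => ?_)
  simpa using norm_sub_le p.1 p.2

variable [Nontrivial E]

theorem energyKer_integrable (x : E) : Integrable (energyKer x) := by
  have hb : Integrable (fun t : E => (fun r : ℝ => 4 * (1 + ‖x‖ ^ 2) * (r ^ 2 * (1 + r ^ 2)⁻¹) *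
      (r ^ (Module.finrank ℝ E + 1))⁻¹) ‖t‖) := by
    refine (integrable_fun_norm_addHaar (F := ℝ) (volume : Measure E)
      (f := fun r : ℝ => 4 * (1 + ‖x‖ ^ 2) * (r ^ 2 * (1 + r ^ 2)⁻¹) *
        (r ^ (Module.finrank ℝ E + 1))⁻¹)).2 ?_
    have h : IntegrableOn (fun y : ℝ => 4 * (1 + ‖x‖ ^ 2) * (1 + y ^ 2)⁻¹) (Ioi 0) :=
      (integrable_inv_one_add_sq.const_mul _).integrableOn
    refine h.congr_fun ?_ measurableSet_Ioi
    intro y hy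
    have hy : (0 : ℝ) < y := hy
    obtain ⟨n, hn⟩ : ∃ n, Module.finrank ℝ E = n + 1 :=
      Nat.exists_eq_succ_of_ne_zero Module.finrank_pos.ne'
    simp only [hn, smul_eq_mul, Nat.add_sub_cancel]
    field_simp
    ring
  refine hb.mono' ?_ ?_
  · exact (energyKer_measurable.comp measurable_prodMk_left).aestronglyMeasurable
  · refine Filter.Eventually.of_forall fun t => ?_
    rw [Real.norm_of_nonneg (energyKer_nonneg x t)]
    exact mul_le_mul_of_nonneg_right (one_sub_cos_bound x t) (by positivity)

theorem energyKer_integral (u : E) (hu : ‖u‖ = 1) (x : E) :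
    ∫ t, energyKer x t = (∫ t, energyKer u t) * ‖x‖ := by
  rcases eq_or_ne x 0 with rfl | hx
  · simp [energyKer]
  have hr : 0 < ‖x‖ := norm_pos_iff.mpr hx
  have hn : ‖‖x‖ • u‖ = ‖x‖ := by rw [norm_smul, hu]; simp
  set e := (Submodule.span ℝ {‖x‖ • u - x})ᗮ.reflection with he
  have hex : e (‖x‖ • u) = x := Submodule.reflection_sub hn
  have h1 : ∫ t, energyKer x t = ∫ t, energyKer (‖x‖ • u) t := by
    rw [← (e.measurePreserving).integral_comp e.toHomeomorph.measurableEmbedding]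
    refine integral_congr_ae (Filter.Eventually.of_forall fun t => ?_)
    have hi : (inner ℝ x (e t) : ℝ) = inner ℝ (‖x‖ • u) t := by
      rw [← e.inner_map_map (‖x‖ • u) t, hex]
    simp only [energyKer, hi, e.norm_map]
  have h2 : ∀ t, energyKer (‖x‖ • u) t =
      ‖x‖ ^ (Module.finrank ℝ E + 1) * energyKer u (‖x‖ • t) := by
    intro t
    simp only [energyKer, inner_smul_left, inner_smul_right, norm_smul, norm_norm, mul_pow, mul_inv]
    have : ‖x‖ ^ (Module.finrank ℝ E + 1) ≠ 0 := by positivity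
    simp only [conj_trivial]
    rw [mul_left_comm, mul_inv_cancel_left₀ this]
  rw [h1]
  simp_rw [h2]
  rw [integral_const_mul, Measure.integral_comp_smul, abs_of_pos (by positivity), smul_eq_mul,
    pow_succ]
  field_simp

theorem ae_ne_zero_E : ∀ᵐ t : E, t ≠ 0 := by
  simp [ae_iff]

theorem energyKer_integral_pos (u : E) (hu : ‖u‖ = 1) : 0 < ∫ t, energyKer u t := by
  refine lt_of_le_of_ne (integral_nonneg (energyKer_nonneg u)) fun h => ?_
  have h0 := (integral_eq_zero_iff_of_nonneg (energyKer_nonneg u) (energyKer_integrable u)).1 h.symm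
  have h1 : (fun t : E => Real.cos (inner ℝ u t)) =ᵐ[volume] fun _ => (1 : ℝ) := by
    filter_upwards [h0, ae_ne_zero_E] with t ht ht0
    have : (‖t‖ ^ (Module.finrank ℝ E + 1))⁻¹ ≠ 0 := by
      have := norm_pos_iff.mpr ht0
      positivity
    have := (mul_eq_zero.1 ht).resolve_right this
    linarith
  have h2 := congrFun ((Continuous.ae_eq_iff_eq volume (by fun_prop) (by fun_prop)).1 h1) u
  simp only [real_inner_self_eq_norm_sq, hu] at h2
  have := Real.cos_one_le
  norm_num at h2 this
  linarith

theorem energy_key {μ ν : Measure E} [IsProbabilityMeasure μ] [IsProbabilityMeasure ν]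
    (hμ : Integrable (fun x => ‖x‖) μ) (hν : Integrable (fun x => ‖x‖) ν)
    (u : E) (hu : ‖u‖ = 1) :
    Integrable (fun t : E => (1 - (charFun μ t * (starRingEnd ℂ) (charFun ν t)).re) *
      (‖t‖ ^ (Module.finrank ℝ E + 1))⁻¹) ∧
    (∫ t, energyKer u t) * ∫ p, ‖p.1 - p.2‖ ∂(μ.prod ν) =
      ∫ t : E, (1 - (charFun μ t * (starRingEnd ℂ) (charFun ν t)).re) *
      (‖t‖ ^ (Module.finrank ℝ E + 1))⁻¹ := by
  have hK : ∀ p : E × E, ∫ t, energyKer (p.1 - p.2) t = (∫ t, energyKer u t) * ‖p.1 - p.2‖ :=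
    fun p => energyKer_integral u hu _
  generalize ∫ t, energyKer u t = C at hK ⊢
  have hm : Measurable (fun q : (E × E) × E => energyKer (q.1.1 - q.1.2) q.2) :=
    energyKer_measurable.comp (f := fun q : (E × E) × E => (q.1.1 - q.1.2, q.2)) (by fun_prop)
  have hI : Integrable (fun q : (E × E) × E => energyKer (q.1.1 - q.1.2) q.2)
      ((μ.prod ν).prod volume) := by
    rw [integrable_prod_iff hm.aestronglyMeasurable]
    refine ⟨Filter.Eventually.of_forall fun p => energyKer_integrable (p.1 - p.2), ?_⟩
    simp only [Real.norm_of_nonneg (energyKer_nonneg _ _), hK]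
    exact (norm_sub_integrable hμ hν).const_mul _
  have hin : ∀ t : E, ∫ p : E × E, energyKer (p.1 - p.2) t ∂(μ.prod ν) =
      (1 - (charFun μ t * (starRingEnd ℂ) (charFun ν t)).re) *
      (‖t‖ ^ (Module.finrank ℝ E + 1))⁻¹ := by
    intro t
    simp only [energyKer]
    rw [integral_mul_const, integral_sub (integrable_const _), integral_cos_prod]
    · simp
    · refine Integrable.of_bound (C := 1) (by fun_prop) (Filter.Eventually.of_forall fun p => ?_)
      exact Real.abs_cos_le_one _
  constructor
  · have := hI.integral_prod_right
    simpa only [hin] using this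
  · have := integral_integral_swap (f := fun (p : E × E) (t : E) => energyKer (p.1 - p.2) t) hI
    simp only [hin] at this
    rw [← this]
    simp only [hK, integral_const_mul]

end EnergyAux

theorem energyDist_aux {D : ℕ} (μ ν : Measure (EuclideanSpace ℝ (Fin D)))
    [IsProbabilityMeasure μ] [IsProbabilityMeasure ν]
    (hμ : Integrable (fun x => ‖x‖) μ) (hν : Integrable (fun x => ‖x‖) ν) :
    0 ≤ energyDist μ ν ∧ (energyDist μ ν = 0 ↔ μ = ν) := by
  have hself : μ = ν → energyDist μ ν = 0 := by
    rintro rfl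
    unfold energyDist
    ring
  rcases subsingleton_or_nontrivial (EuclideanSpace ℝ (Fin D)) with hs | hs
  · have : μ = ν := by
      ext s _
      rcases Subsingleton.eq_empty_or_singleton (s := s) (Set.subsingleton_of_subsingleton)
        with rfl | ⟨a, rfl⟩
      · simp
      · have : ({a} : Set (EuclideanSpace ℝ (Fin D))) = univ := Subsingleton.eq_univ_of_nonempty ⟨a, rfl⟩
        rw [this]; simp
    have h0 := hself this
    exact ⟨h0.ge, fun _ => this, hself⟩
  obtain ⟨u, hu⟩ := exists_norm_eq (EuclideanSpace ℝ (Fin D)) (zero_le_one' ℝ)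
  obtain ⟨i1, e1⟩ := energy_key hμ hν u hu
  obtain ⟨i2, e2⟩ := energy_key hμ hμ u hu
  obtain ⟨i3, e3⟩ := energy_key hν hν u hu
  have hC := energyKer_integral_pos u hu
  set C := ∫ t, energyKer u t with hCdef
  set n := Module.finrank ℝ (EuclideanSpace ℝ (Fin D)) + 1
  have hpt : ∀ t : EuclideanSpace ℝ (Fin D),
      2 * ((1 - (charFun μ t * (starRingEnd ℂ) (charFun ν t)).re) * (‖t‖ ^ n)⁻¹)
      - ((1 - (charFun μ t * (starRingEnd ℂ) (charFun μ t)).re) * (‖t‖ ^ n)⁻¹)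
      - ((1 - (charFun ν t * (starRingEnd ℂ) (charFun ν t)).re) * (‖t‖ ^ n)⁻¹)
      = Complex.normSq (charFun μ t - charFun ν t) * (‖t‖ ^ n)⁻¹ := by
    intro t
    simp only [Complex.normSq_apply, Complex.mul_re, Complex.conj_re, Complex.conj_im,
      Complex.sub_re, Complex.sub_im]
    ring
  have iN := ((i1.const_mul 2).sub i2).sub i3
  have hE : C * energyDist μ ν =
      ∫ t, Complex.normSq (charFun μ t - charFun ν t) * (‖t‖ ^ n)⁻¹ := by
    simp_rw [← hpt]
    have s1 := integral_sub ((i1.const_mul 2).sub i2) i3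
    have s2 := integral_sub (i1.const_mul 2) i2
    simp only [Pi.sub_apply] at s1 s2
    rw [s1, s2, integral_const_mul, ← e1, ← e2, ← e3]
    unfold energyDist
    ring
  have hnn : 0 ≤ fun t : EuclideanSpace ℝ (Fin D) =>
      Complex.normSq (charFun μ t - charFun ν t) * (‖t‖ ^ n)⁻¹ := fun t =>
    mul_nonneg (Complex.normSq_nonneg _) (by positivity)
  refine ⟨nonneg_of_mul_nonneg_right (hE ▸ integral_nonneg hnn) hC, fun h => ?_, hself⟩
  rw [h, mul_zero] at hE
  have iN' : Integrable (fun t : EuclideanSpace ℝ (Fin D) =>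
      Complex.normSq (charFun μ t - charFun ν t) * (‖t‖ ^ n)⁻¹) :=
    iN.congr (Filter.Eventually.of_forall hpt)
  have h0 := (integral_eq_zero_iff_of_nonneg hnn iN').1 hE.symm
  apply Measure.ext_of_charFun
  rw [← Continuous.ae_eq_iff_eq volume continuous_charFun continuous_charFun]
  filter_upwards [h0, ae_ne_zero_E] with t ht ht0
  have : (‖t‖ ^ n)⁻¹ ≠ 0 := by
    have := norm_pos_iff.mpr ht0
    positivity
  exact sub_eq_zero.1 (Complex.normSq_eq_zero.1 ((mul_eq_zero.1 ht).resolve_right this))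

theorem integral_energyScore {D : ℕ} (μ ν : Measure (EuclideanSpace ℝ (Fin D)))
    [IsProbabilityMeasure μ] [IsProbabilityMeasure ν]
    (hμ : Integrable (fun x => ‖x‖) μ) (hν : Integrable (fun x => ‖x‖) ν) :
    ∫ y, energyScore μ y ∂ν = ∫ p, ‖p.1 - p.2‖ ∂(μ.prod ν)
      - (1 / 2) * ∫ p, ‖p.1 - p.2‖ ∂(μ.prod μ) := by
  have h := norm_sub_integrable hμ hν
  unfold energyScore
  rw [integral_sub h.integral_prod_right (integrable_const _), integral_prod_symm _ h]
  simp

/-- **The energy score is a strictly proper scoring rule**: for probability measures `μ`, `ν`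
on `ℝ^D` with finite first moments,
`E_{Y∼ν}[ES(μ,Y)] − E_{Y∼ν}[ES(ν,Y)] = (1/2)·ED(μ,ν) ≥ 0`; in particular the expected energy
score is minimized (uniquely) at `μ = ν`. -/
theorem energyScore_strictly_proper {D : ℕ}
    (μ ν : Measure (EuclideanSpace ℝ (Fin D)))
    [IsProbabilityMeasure μ] [IsProbabilityMeasure ν]
    (hμ : Integrable (fun x => ‖x‖) μ) (hν : Integrable (fun x => ‖x‖) ν) :
    (∫ y, energyScore μ y ∂ν - ∫ y, energyScore ν y ∂ν = (1 / 2) * energyDist μ ν) ∧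
    0 ≤ (1 / 2) * energyDist μ ν ∧
    (∫ y, energyScore ν y ∂ν ≤ ∫ y, energyScore μ y ∂ν) ∧
    (∫ y, energyScore μ y ∂ν = ∫ y, energyScore ν y ∂ν ↔ μ = ν) := by
  have h1 := integral_energyScore μ ν hμ hν
  have h2 := integral_energyScore ν ν hν hν
  obtain ⟨h3, h4⟩ := energyDist_aux μ ν hμ hν
  have h5 : ∫ y, energyScore μ y ∂ν - ∫ y, energyScore ν y ∂ν = (1 / 2) * energyDist μ ν := by
    rw [h1, h2]
    unfold energyDist
    ring
  refine ⟨h5, by linarith, by linarith, ?_⟩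
  rw [← h4]
  constructor <;> intro h <;> linarith
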